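/- Let R be a Noetherian local ring, S an R-algebra that is finitely generated as an R-module. Then Hom_R(S, E(R/m)) is, as an S-module, isomorphic to the direct sum ⊕_{n ∈ Max(S)} E_S(S/n) of the injective hulls of the residue fields at the (finitely many) maximal ideals of S, each appearing with multiplicity one. -/

import Mathlib

open CategoryTheory IsLocalRing Pointwise

noncomputable section

/-- `E` is an injective hull of `S ⧸ J` over `S`. -/
def IsInjHull (S : Type) [CommRing S] (J : Ideal S) (E : Type) [AddCommGroup E]
    [Module S E] : Prop :=
  Module.Injective S E ∧
    ∃ f : (S ⧸ J) →ₗ[S] E, Function.Injective f ∧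
      ∀ N : Submodule S E, N ≠ ⊥ → N ⊓ LinearMap.range f ≠ ⊥

/-- Local cohomology `H^i_J(M)`. -/
abbrev LC (S : Type) [CommRing S] (J : Ideal S) (i : ℕ) (M : ModuleCat S) : ModuleCat S :=
  (localCohomology J i).obj M

/-- Krull dimension of a module (dimension of its support). -/
def mdim (S : Type) [CommRing S] (M : Type) [AddCommGroup M] [Module S M] : WithBot ℕ∞ :=
  Order.krullDim (Module.support S M)

/-- Depth/grade of an ideal `J` on `M`: supremum of lengths of `M`-regular sequences in `J`. -/
def gradeI (S : Type) [CommRing S] (J : Ideal S) (M : Type) [AddCommGroup M]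
    [Module S M] : ℕ∞ :=
  sSup {n : ℕ∞ | ∃ rs : List S, (rs.length : ℕ∞) = n ∧ (∀ r ∈ rs, r ∈ J) ∧
    RingTheory.Sequence.IsRegular M rs}

/-- The local "height" of `M` at a prime `p`, i.e. `dim_{S_p} M_p`. -/
def htM (S : Type) [CommRing S] (M : Type) [AddCommGroup M] [Module S M]
    (p : PrimeSpectrum S) : WithBot ℕ∞ :=
  mdim (Localization.AtPrime p.asIdeal) (LocalizedModule p.asIdeal.primeCompl M)

/-- `ht_M(a) = inf { dim_{S_p} M_p : p ⊇ a, p ∈ Supp M }`. -/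
def htI (S : Type) [CommRing S] (M : Type) [AddCommGroup M] [Module S M]
    (a : Ideal S) : WithBot ℕ∞ :=
  sInf {d | ∃ p ∈ Module.support S M, a ≤ p.asIdeal ∧ d = htM S M p}

/-- Serre's condition `S_n` for the module `M`. -/
def Serre (S : Type) [CommRing S] (n : ℕ) (M : Type) [AddCommGroup M] [Module S M] : Prop :=
  ∀ (p : Ideal S) [p.IsPrime],
    min (n : WithBot ℕ∞)
        (mdim (Localization.AtPrime p) (LocalizedModule p.primeCompl M)) ≤
      (gradeI (Localization.AtPrime p) (IsLocalRing.maximalIdeal (Localization.AtPrime p))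
        (LocalizedModule p.primeCompl M) : ℕ∞)

/-- Attached primes of `M` (Macdonald): primes of the form `Ann(M ⧸ N)`. -/
def attachedPrimes (S : Type) [CommRing S] (M : Type) [AddCommGroup M] [Module S M] :
    Set (Ideal S) :=
  {p | p.IsPrime ∧ ∃ N : Submodule S M, p = Module.annihilator S (M ⧸ N)}

/-- `ω` is a canonical module of the `d`-dimensional module `M` over `(S, J)`:
its "Matlis dual" `Hom_S(ω, E)` is isomorphic to `H^d_J(M)`. -/
def IsCanonicalModule (S : Type) [CommRing S] (J : Ideal S) (d : ℕ)
    (M ω : ModuleCat S) : Prop :=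
  Module.Finite S ω ∧ ∃ E : ModuleCat S, IsInjHull S J ↥E ∧
    Nonempty ((↥ω →ₗ[S] ↥E) ≃ₗ[S] ↥(LC S J d M))

/-- `(S, J)` is quasi-Gorenstein: `H^d_J(S)` is an injective hull of `S ⧸ J`, `d = dim S`. -/
def IsQuasiGorensteinAt (S : Type) [CommRing S] (J : Ideal S) : Prop :=
  ∃ d : ℕ, ringKrullDim S = (d : WithBot ℕ∞) ∧
    ∃ E : ModuleCat S, IsInjHull S J ↥E ∧
      Nonempty (↥(LC S J d (ModuleCat.of S S)) ≃ₗ[S] ↥E)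

/-- Totally reflexive modules. -/
def TotallyReflexive (S : Type) [CommRing S] (M : ModuleCat S) : Prop :=
  Module.Finite S ↥M ∧ Module.IsReflexive S ↥M ∧
    ∀ i : ℕ, 0 < i →
      Subsingleton ↥(((Ext S (ModuleCat S) i).obj (Opposite.op M)).obj (ModuleCat.of S S)) ∧
      Subsingleton ↥(((Ext S (ModuleCat S) i).obj
        (Opposite.op (ModuleCat.of S (Module.Dual S ↥M)))).obj (ModuleCat.of S S))

/-- `G`-dimension at most `n`. -/
def GdimLE (S : Type) [CommRing S] : ℕ → ModuleCat S → Prop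
  | 0, M => TotallyReflexive S M
  | n + 1, M => ∃ (G : ModuleCat S) (f : ↥G →ₗ[S] ↥M), Function.Surjective f ∧
      TotallyReflexive S G ∧ GdimLE S n (ModuleCat.of S (LinearMap.ker f))

/-- Injective dimension at most `n`. -/
def InjDimLE (S : Type) [CommRing S] : ℕ → ModuleCat S → Prop
  | 0, M => Module.Injective S ↥M
  | n + 1, M => ∃ (E : ModuleCat S) (f : ↥M →ₗ[S] ↥E), Function.Injective f ∧
      Module.Injective S ↥E ∧ InjDimLE S n (ModuleCat.of S (↥E ⧸ LinearMap.range f))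

/-- Injective dimension, as an element of `ℕ∞`. -/
def injDim (S : Type) [CommRing S] (M : ModuleCat S) : ℕ∞ :=
  sInf {n : ℕ∞ | ∃ k : ℕ, (k : ℕ∞) = n ∧ InjDimLE S k M}

/-- Minimal number of generators. -/
def genNumber (S : Type) [CommRing S] (M : Type) [AddCommGroup M] [Module S M] : ℕ∞ :=
  sInf {n : ℕ∞ | ∃ s : Finset M, (s.card : ℕ∞) = n ∧ Submodule.span S (↑s : Set M) = ⊤}

/-- The socle `0 :_M J`. -/
def socle (S : Type) [CommRing S] (J : Ideal S) (M : Type) [AddCommGroup M] [Module S M] :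
    Submodule S M :=
  ⨅ r ∈ J, LinearMap.ker (LinearMap.lsmul S M r)

/-- Limit closure of the sequence `x` on `M`. -/
def limClo (S : Type) [CommRing S] {v : ℕ} (x : Fin v → S) (M : Type) [AddCommGroup M]
    [Module S M] : Submodule S M :=
  ⨆ t : ℕ, (Ideal.span (Set.range fun i => x i ^ (t + 1)) • (⊤ : Submodule S M)).comap
      (LinearMap.lsmul S M ((∏ i, x i) ^ t))

end

/-- Krull dimension of a ring, valued in `WithBot ℕ∞`. -/
noncomputable def rdim (S : Type) [CommRing S] : WithBot ℕ∞ :=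
  Order.krullDim (PrimeSpectrum S)
section Stmt13

open DirectSum

variable (R A E : Type) [CommRing R] [CommRing A] [Algebra R A]
  [AddCommGroup E] [Module R E]

/-- The `A`-module structure on `Hom_R(A, E)` given by `(a • f) t = f (a * t)`. -/
noncomputable instance instSMulHomAlg : SMul A (A →ₗ[R] E) :=
  ⟨fun a f => f ∘ₗ LinearMap.mulLeft R a⟩

theorem smul_hom_apply (a : A) (f : A →ₗ[R] E) (t : A) : (a • f) t = f (a * t) := rfl

noncomputable instance instModuleHomAlg : Module A (A →ₗ[R] E) where
  one_smul f := by ext t; simp [smul_hom_apply]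
  mul_smul a b f := by ext t; simp [smul_hom_apply, mul_assoc, mul_left_comm]
  smul_zero a := by ext t; simp [smul_hom_apply]
  smul_add a f g := by ext t; simp [smul_hom_apply]
  add_smul a b f := by ext t; simp [smul_hom_apply, add_mul]
  zero_smul f := by ext t; simp [smul_hom_apply]

section AssociatedPrimes

variable {S M : Type} [CommRing S] [AddCommGroup M] [Module S M]

theorem Submodule.exists_mem_torsionOf_isPrime [IsNoetherianRing S] {N : Submodule S M}
    (hN : N ≠ ⊥) : ∃ y ∈ N, (Ideal.torsionOf S M y).IsPrime := by
  obtain ⟨x, hx, hx0⟩ := N.exists_mem_ne_zero_of_ne_bot hN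
  obtain ⟨P, hP, -⟩ := exists_le_isAssociatedPrime_of_isNoetherianRing S (⟨x, hx⟩ : N)
    (by simpa using hx0)
  obtain ⟨hP, y, rfl⟩ := (isAssociatedPrime_iff).1 hP
  refine ⟨y, y.2, ?_⟩
  convert hP using 1
  ext r
  simp [Ideal.mem_torsionOf_iff, Submodule.mem_colon_singleton, Subtype.ext_iff]

theorem Ideal.torsionOf_smul_of_isPrime {x : M} (hx : (torsionOf S M x).IsPrime) {a : S}
    (ha : a • x ≠ 0) : torsionOf S M (a • x) = torsionOf S M x := by
  ext r
  rw [mem_torsionOf_iff, smul_smul, ← mem_torsionOf_iff, hx.mul_mem_iff_mem_or_mem,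
    or_iff_left (by rwa [mem_torsionOf_iff])]

theorem Ideal.IsMaximal.torsionOf_eq {J : Ideal S} (hJ : J.IsMaximal) {x : M} (hx : x ≠ 0)
    (h : ∀ r ∈ J, r • x = 0) : torsionOf S M x = J :=
  (hJ.eq_of_le (fun e => hx ((torsionOf_eq_top_iff S x).1 e)) h).symm

variable {J : Ideal S} {f : (S ⧸ J) →ₗ[S] M}

theorem exists_smul_mem_range_of_essential
    (hess : ∀ N : Submodule S M, N ≠ ⊥ → N ⊓ LinearMap.range f ≠ ⊥)
    {x : M} (hx : x ≠ 0) :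
    ∃ a : S, a • x ≠ 0 ∧ a • x ∈ LinearMap.range f := by
  obtain ⟨z, hz, hz0⟩ := Submodule.exists_mem_ne_zero_of_ne_bot
    (hess (Submodule.span S {x}) (by simpa using hx))
  obtain ⟨a, rfl⟩ := Submodule.mem_span_singleton.1 hz.1
  exact ⟨a, hz0, hz.2⟩

theorem torsionOf_eq_of_essential [hJ : J.IsMaximal]
    (hess : ∀ N : Submodule S M, N ≠ ⊥ → N ⊓ LinearMap.range f ≠ ⊥)
    {x : M} (hx : (Ideal.torsionOf S M x).IsPrime) :
    Ideal.torsionOf S M x = J := by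
  have hx0 : x ≠ 0 := by
    rintro rfl
    exact hx.ne_top (by simp)
  obtain ⟨a, ha, c, hc⟩ := exists_smul_mem_range_of_essential hess hx0
  rw [← Ideal.torsionOf_smul_of_isPrime hx ha]
  refine hJ.torsionOf_eq ha fun r hr => ?_
  obtain ⟨c, rfl⟩ := Ideal.Quotient.mk_surjective c
  rw [← hc, ← map_smul, ← Ideal.Quotient.mk_eq_mk, ← Submodule.Quotient.mk_smul,
    (Submodule.Quotient.mk_eq_zero J).2 (by simpa using J.mul_mem_right c hr), map_zero]

theorem mem_range_of_essential [hJ : J.IsMaximal]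
    (hess : ∀ N : Submodule S M, N ≠ ⊥ → N ⊓ LinearMap.range f ≠ ⊥)
    {x : M} (h : ∀ r ∈ J, r • x = 0) : x ∈ LinearMap.range f := by
  by_cases hx : x = 0
  · exact hx ▸ zero_mem _
  obtain ⟨a, ha, hac⟩ := exists_smul_mem_range_of_essential hess hx
  obtain ⟨b, i, hi, hb⟩ := hJ.exists_inv (x := a) fun haJ => ha (h a haJ)
  have : x = b • a • x := by
    rw [smul_smul]
    nth_rw 1 [← one_smul S x, ← hb, add_smul, h i hi, add_zero]
  exact this ▸ Submodule.smul_mem _ b hac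

end AssociatedPrimes

section Coinduced

variable {R A E}

theorem injective_hom_of_injective [hE : Module.Injective R E] :
    Module.Injective A (A →ₗ[R] E) where
  out X Y _ _ _ _ i hi g := by
    let : Module R X := Module.compHom X (algebraMap R A)
    let : Module R Y := Module.compHom Y (algebraMap R A)
    have : IsScalarTower R A X := .of_algebraMap_smul fun _ _ => rfl
    have : IsScalarTower R A Y := .of_algebraMap_smul fun _ _ => rfl
    let φ : X →ₗ[R] E :=
      { toFun x := g x 1
        map_add' x y := by simp
        map_smul' r x := by
          rw [← algebraMap_smul A r x, map_smul, smul_hom_apply, mul_one, RingHom.id_apply,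
            Algebra.algebraMap_eq_smul_one, map_smul] }
    obtain ⟨ψ, hψ⟩ := hE.out (i.restrictScalars R) hi φ
    refine ⟨{ toFun y := ψ ∘ₗ (LinearMap.toSpanSingleton A Y y).restrictScalars R
              map_add' y z := by ext; simp
              map_smul' a y := by
                ext t
                simp [smul_hom_apply, smul_smul, mul_comm] }, fun x => ?_⟩
    ext a
    have : ψ (a • i x) = g x a := by
      rw [← map_smul]
      refine (hψ (a • x)).trans ?_
      change g (a • x) 1 = _
      rw [map_smul, smul_hom_apply, mul_one]
    simpa using this

theorem isMaximal_torsionOf_hom [IsLocalRing R] [Module.Finite R A]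
    {f : (R ⧸ maximalIdeal R) →ₗ[R] E}
    (hess : ∀ N : Submodule R E, N ≠ ⊥ → N ⊓ LinearMap.range f ≠ ⊥) {y : A →ₗ[R] E}
    (hy : (Ideal.torsionOf A (A →ₗ[R] E) y).IsPrime) :
    (Ideal.torsionOf A (A →ₗ[R] E) y).IsMaximal := by
  obtain ⟨s, hs⟩ := Module.Finite.fg_top (R := R) (M := A)
  have hcomap : (Ideal.torsionOf A (A →ₗ[R] E) y).comap (algebraMap R A) =
      s.inf fun a => Ideal.torsionOf R E (y a) := by
    ext r
    have hr : algebraMap R A r • y = r • y := by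
      ext t
      rw [smul_hom_apply, ← Algebra.smul_def, map_smul, LinearMap.smul_apply]
    rw [Ideal.mem_comap, Ideal.mem_torsionOf_iff, hr, Submodule.mem_finsetInf]
    simp only [Ideal.mem_torsionOf_iff]
    refine ⟨fun h a _ => LinearMap.congr_fun h a, fun h => ?_⟩
    exact LinearMap.ext_on hs fun a ha => by simpa using h a ha
  have hp := hy.comap (algebraMap R A)
  obtain ⟨a, -, ha⟩ := Ideal.eq_inf_of_isPrime_inf (hcomap ▸ hp)
  rw [← hcomap] at ha
  refine Ideal.isMaximal_of_isIntegral_of_isMaximal_comap (R := R) _ ?_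
  rw [← ha, torsionOf_eq_of_essential hess (ha ▸ hp)]
  infer_instance

theorem exists_dual_generator (K L : Type) [Field K] [Field L] [Algebra K L] [Module.Finite K L] :
    ∃ t : L →ₗ[K] K, t ≠ 0 ∧ ∀ g : L →ₗ[K] K, ∃ c : L, ∀ x, g x = t (c * x) := by
  obtain ⟨t, ht⟩ := exists_ne (0 : L →ₗ[K] K)
  refine ⟨t, ht, fun g => ?_⟩
  let Φ : L →ₗ[K] Module.Dual K L := (LinearMap.mul K L).compr₂ t
  have hΦ : Function.Injective Φ := by
    refine (injective_iff_map_eq_zero Φ).2 fun c hc => ?_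
    by_contra hc0
    refine ht (LinearMap.ext fun x => ?_)
    have := LinearMap.congr_fun hc (c⁻¹ * x)
    simpa [Φ, mul_inv_cancel_left₀ hc0] using this
  obtain ⟨c, hc⟩ := (LinearMap.injective_iff_surjective_of_finrank_eq_finrank
    (Subspace.dual_finrank_eq (K := K) (V := L)).symm).1 hΦ g
  exact ⟨c, fun x => (LinearMap.congr_fun hc x).symm⟩

theorem exists_residue_functional [IsLocalRing R] [Module.Finite R A] (n : Ideal A)
    [hn : n.IsMaximal] :
    ∃ t : A →ₗ[R] (R ⧸ maximalIdeal R), t ≠ 0 ∧ (∀ a ∈ n, t a = 0) ∧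
      ∀ g : A →ₗ[R] (R ⧸ maximalIdeal R), (∀ a ∈ n, g a = 0) → ∃ c, ∀ x, g x = t (c * x) := by
  have : n.LiesOver (maximalIdeal R) :=
    ⟨(eq_maximalIdeal (Ideal.isMaximal_comap_of_isIntegral_of_isMaximal n)).symm⟩
  let : Field (R ⧸ maximalIdeal R) := Ideal.Quotient.field _
  let : Field (A ⧸ n) := Ideal.Quotient.field _
  have : Module.Finite (R ⧸ maximalIdeal R) (A ⧸ n) :=
    Module.Finite.of_restrictScalars_finite R _ _
  obtain ⟨t, ht, hgen⟩ := exists_dual_generator (R ⧸ maximalIdeal R) (A ⧸ n)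
  let π : A →ₗ[R] A ⧸ n := (Ideal.Quotient.mkₐ R n).toLinearMap
  have hπ : Function.Surjective π := Ideal.Quotient.mk_surjective
  refine ⟨t.restrictScalars R ∘ₗ π, fun h => ht ?_, fun a ha => ?_, fun g hg => ?_⟩
  · ext x
    obtain ⟨x, rfl⟩ := hπ x
    exact LinearMap.congr_fun h x
  · have : π a = 0 := Ideal.Quotient.eq_zero_iff_mem.2 ha
    simp [this]
  · let g' : (A ⧸ n) →ₗ[R] (R ⧸ maximalIdeal R) := (n.restrictScalars R).liftQ g hg
    obtain ⟨c, hc⟩ := hgen (g'.extendScalarsOfSurjective Ideal.Quotient.mk_surjective)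
    obtain ⟨c, rfl⟩ := hπ c
    exact ⟨c, fun x => hc (π x)⟩

theorem exists_quotient_hom_range_eq_socle [IsLocalRing R] [Module.Finite R A]
    {f : (R ⧸ maximalIdeal R) →ₗ[R] E} (hf : Function.Injective f)
    (hess : ∀ N : Submodule R E, N ≠ ⊥ → N ⊓ LinearMap.range f ≠ ⊥) (n : Ideal A)
    [hn : n.IsMaximal] :
    ∃ h : (A ⧸ n) →ₗ[A] (A →ₗ[R] E), Function.Injective h ∧
      ∀ y : A →ₗ[R] E, (∀ a ∈ n, a • y = 0) → y ∈ LinearMap.range h := by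
  obtain ⟨t, ht, htn, hgen⟩ := exists_residue_functional (R := R) n
  let h : (A ⧸ n) →ₗ[A] (A →ₗ[R] E) :=
    n.liftQ (LinearMap.toSpanSingleton A (A →ₗ[R] E) (f ∘ₗ t)) fun a ha => by
      ext x
      simp [smul_hom_apply, htn _ (n.mul_mem_right x ha)]
  have happ (a x : A) : h (Submodule.Quotient.mk a) x = f (t (a * x)) := rfl
  refine ⟨h, ?_, fun y hy => ?_⟩
  · have : IsSimpleModule A (A ⧸ n) := isSimpleModule_iff_isCoatom.2 (Ideal.isMaximal_def.1 hn)
    refine h.injective_or_eq_zero.resolve_right fun h0 => ht (LinearMap.ext fun x => hf ?_)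
    have := happ 1 x
    rw [h0, one_mul] at this
    simpa using this.symm
  · have hm : ∀ r ∈ maximalIdeal R, algebraMap R A r ∈ n := by
      rw [← eq_maximalIdeal (Ideal.isMaximal_comap_of_isIntegral_of_isMaximal (R := R) n)]
      exact fun r hr => hr
    have hyf (x : A) : y x ∈ LinearMap.range f := mem_range_of_essential hess fun r hr => by
      have := LinearMap.congr_fun (hy _ (hm r hr)) x
      rwa [smul_hom_apply, ← Algebra.smul_def, map_smul] at this
    let g : A →ₗ[R] (R ⧸ maximalIdeal R) :=
      (LinearEquiv.ofInjective f hf).symm.toLinearMap ∘ₗ y.codRestrict _ hyf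
    have hg (x : A) : f (g x) = y x :=
      congrArg Subtype.val ((LinearEquiv.ofInjective f hf).apply_symm_apply ⟨y x, hyf x⟩)
    obtain ⟨c, hc⟩ := hgen g fun a ha => hf <| by
      rw [hg, map_zero, ← mul_one a, ← smul_hom_apply, hy a ha, LinearMap.zero_apply]
    refine ⟨Submodule.Quotient.mk c, LinearMap.ext fun x => ?_⟩
    rw [happ, ← hc, hg]

theorem finite_setOf_isMaximal_of_isLocalRing (R A : Type) [CommRing R] [IsLocalRing R] [CommRing A]
    [Algebra R A] [Module.Finite R A] : {n : Ideal A | n.IsMaximal}.Finite :=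
  (Algebra.QuasiFinite.finite_primesOver (S := A) (maximalIdeal R)).subset fun n hn =>
    ⟨hn.isPrime, ⟨(eq_maximalIdeal
      (@Ideal.isMaximal_comap_of_isIntegral_of_isMaximal R _ A _ _ _ n hn)).symm⟩⟩

end Coinduced

section DirectSum

variable {S ι : Type} [CommRing S] [DecidableEq ι] {n : ι → Ideal S}
  {D : ι → Type} [∀ i, AddCommGroup (D i)] [∀ i, Module S (D i)]

theorem exists_of_torsionOf_directSum_isPrime [Fintype ι] (hn : ∀ i, (n i).IsMaximal)
    (hinj : Function.Injective n) {f : ∀ i, (S ⧸ n i) →ₗ[S] D i}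
    (hess : ∀ i, ∀ N : Submodule S (D i), N ≠ ⊥ → N ⊓ LinearMap.range (f i) ≠ ⊥)
    {y : ⨁ i, D i} (hy : (Ideal.torsionOf S (⨁ i, D i) y).IsPrime) :
    ∃ i c, y = DirectSum.lof S ι D i (f i c) := by
  have hinf : Ideal.torsionOf S (⨁ i, D i) y =
      Finset.univ.inf fun i => Ideal.torsionOf S (D i) (y i) := by
    ext r
    rw [Submodule.mem_finsetInf]
    simp only [Ideal.mem_torsionOf_iff, Finset.mem_univ, true_implies]
    exact ⟨fun h i => by rw [← DirectSum.smul_apply, h]; rfl,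
      fun h => DFinsupp.ext fun i => (DirectSum.smul_apply r y i).trans (h i)⟩
  obtain ⟨i, -, hi⟩ := Ideal.eq_inf_of_isPrime_inf (hinf ▸ hy)
  rw [← hinf] at hi
  have hyi : Ideal.torsionOf S (⨁ i, D i) y = n i :=
    hi ▸ torsionOf_eq_of_essential (hJ := hn i) (hess i) (hi ▸ hy)
  have hann (j : ι) (r : S) (hr : r ∈ n i) : r • y j = 0 := by
    rw [← hyi, Ideal.mem_torsionOf_iff] at hr
    rw [← DirectSum.smul_apply, hr]
    rfl
  obtain ⟨c, hc⟩ := mem_range_of_essential (hJ := hn i) (hess i) (hann i)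
  refine ⟨i, c, DFinsupp.ext fun j => ?_⟩
  rw [hc]
  obtain rfl | hij := eq_or_ne i j
  · exact (DirectSum.lof_apply S i (y i)).symm
  · refine Eq.trans ?_ (DirectSum.of_eq_of_ne i j (y i) hij.symm).symm
    by_contra hj
    have hij' := (hn i).torsionOf_eq hj (hann j)
    refine hij (hinj ?_)
    rw [← hij']
    exact torsionOf_eq_of_essential (hJ := hn j) (hess j) (hij' ▸ (hn i).isPrime)

/-- An injective module all of whose associated primes are among the maximal ideals `n i`, with
one-dimensional socle at each `n i`, is the direct sum of the injective hulls of the `S ⧸ n i`. -/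
theorem nonempty_linearEquiv_directSum_of_isInjHull [IsNoetherianRing S] [Fintype ι]
    (hn : ∀ i, (n i).IsMaximal) (hinj : Function.Injective n)
    (hD : ∀ i, IsInjHull S (n i) (D i))
    {H : Type} [AddCommGroup H] [Module S H] [hH : Module.Injective S H]
    (hass : ∀ y : H, (Ideal.torsionOf S H y).IsPrime → ∃ i, Ideal.torsionOf S H y = n i)
    (hsoc : ∀ i, ∃ h : (S ⧸ n i) →ₗ[S] H, Function.Injective h ∧
      ∀ y : H, (∀ a ∈ n i, a • y = 0) → y ∈ LinearMap.range h) :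
    Nonempty (H ≃ₗ[S] ⨁ i, D i) := by
  choose f hf hess using fun i => (hD i).2
  choose h hh hrange using hsoc
  choose g hg using fun i => hH.out (f i) (hf i) (h i)
  let G : (⨁ i, D i) →ₗ[S] H := DirectSum.toModule S ι H g
  have hG (i : ι) (x : D i) : G (DirectSum.lof S ι D i x) = g i x :=
    DirectSum.toModule_lof S i x
  have hGinj : Function.Injective G := by
    rw [← LinearMap.ker_eq_bot]
    by_contra hker
    obtain ⟨y, hy, hprime⟩ := Submodule.exists_mem_torsionOf_isPrime hker
    obtain ⟨i, c, rfl⟩ := exists_of_torsionOf_directSum_isPrime hn hinj hess hprime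
    rw [LinearMap.mem_ker, hG, hg] at hy
    rw [(injective_iff_map_eq_zero _).1 (hh i) c hy] at hprime
    exact hprime.ne_top (by simp)
  choose p hp using fun i => (hD i).1.out G hGinj (DirectSum.component S ι D i)
  let P : H →ₗ[S] ⨁ i, D i :=
    (DirectSum.linearEquivFunOnFintype S ι D).symm.toLinearMap ∘ₗ LinearMap.pi p
  have hPG (y : ⨁ i, D i) : P (G y) = y := by
    refine (LinearEquiv.symm_apply_eq _).2 (funext fun i => ?_)
    exact hp i y
  have hPinj : Function.Injective P := by
    rw [← LinearMap.ker_eq_bot]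
    by_contra hker
    obtain ⟨y, hy, hprime⟩ := Submodule.exists_mem_torsionOf_isPrime hker
    obtain ⟨i, hi⟩ := hass y hprime
    obtain ⟨c, rfl⟩ := hrange i y fun a ha => by rwa [← hi] at ha
    rw [LinearMap.mem_ker, ← hg, ← hG, hPG] at hy
    rw [← hg, ← hG, hy, map_zero] at hprime
    exact hprime.ne_top (by simp)
  exact ⟨LinearEquiv.ofBijective P ⟨hPinj, fun y => ⟨G y, hPG y⟩⟩⟩

end DirectSum

theorem stmt13 (R' A' : Type) [CommRing R'] [IsNoetherianRing R'] [IsLocalRing R']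
    [CommRing A'] [Algebra R' A'] [Module.Finite R' A']
    (E : ModuleCat R') (hE : IsInjHull R' (IsLocalRing.maximalIdeal R') ↥E) :
    {n : Ideal A' | n.IsMaximal}.Finite ∧
    ∀ En : {n : Ideal A' // n.IsMaximal} → ModuleCat A',
      (∀ n : {n : Ideal A' // n.IsMaximal}, IsInjHull A' n.1 ↥(En n)) →
      Nonempty ((A' →ₗ[R'] ↥E) ≃ₗ[A']
        (⨁ n : {n : Ideal A' // n.IsMaximal}, ↥(En n))) := by
  have hfin := finite_setOf_isMaximal_of_isLocalRing R' A'
  refine ⟨hfin, fun En hEn => ?_⟩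
  classical
  have : Fintype {n : Ideal A' // n.IsMaximal} := hfin.fintype
  have : IsNoetherianRing A' := IsNoetherianRing.of_finite R' A'
  obtain ⟨hinj, f, hf, hess⟩ := hE
  have : Module.Injective A' (A' →ₗ[R'] ↥E) := injective_hom_of_injective
  exact nonempty_linearEquiv_directSum_of_isInjHull (fun n => n.2) Subtype.val_injective hEn
    (fun y hy => ⟨⟨_, isMaximal_torsionOf_hom hess hy⟩, rfl⟩)
    fun n => exists_quotient_hom_range_eq_socle hf hess n.1 (hn := n.2)

end Stmt13
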